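/- For every n ≥ 2, r_n divides 2^n x_{n+1}² + x_{n+1} z_{n+1} + 1, and the quotient equals (2^n + 1) w_n x_n z_n + 2^n (2^n + 1) w_n x_n² + z_n + (2^n − 1) x_n + 2^n x_n² y_n + 2^{n+1} x_n² z_n + x_n y_n z_n + 2^{2n} x_n³ + x_n z_n². -/

import Mathlib

namespace Paper

/-- `s i = 2^{ν₂(i+1)}`, the largest power of 2 dividing `i+1`. -/
def s (i : ℕ) : ℕ := 2 ^ padicValNat 2 (i + 1)

/-- Continuant numerators, shifted by 2: `p 0 = p_{-2} = 0`, `p 1 = p_{-1} = 1`,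
and `p (n+2) = p_n = s_n p_{n-1} + p_{n-2}`. -/
def p : ℕ → ℤ
  | 0 => 0
  | 1 => 1
  | n + 2 => (s n : ℤ) * p (n + 1) + p n

/-- Continuant denominators, shifted by 2: `q 0 = q_{-2} = 1`, `q 1 = q_{-1} = 0`,
and `q (n+2) = q_n = s_n q_{n-1} + q_{n-2}`. -/
def q : ℕ → ℤ
  | 0 => 1
  | 1 => 0
  | n + 2 => (s n : ℤ) * q (n + 1) + q n

/-- Hurwitz–Kolden–Frame matrix of a finite sequence. -/
def M (l : List ℤ) : Matrix (Fin 2) (Fin 2) ℤ :=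
  (l.map fun a => !![a, 1; 1, 0]).prod

/-- `u n = (s_1, s_2, ..., s_{2^n - 3})`. -/
def u (n : ℕ) : List ℤ := (List.range (2 ^ n - 3)).map fun i => (s (i + 1) : ℤ)

/-- `v n = (s_1, s_2, ..., s_{2^n - 2})`. -/
def v (n : ℕ) : List ℤ := (List.range (2 ^ n - 2)).map fun i => (s (i + 1) : ℤ)

def c (n : ℕ) : ℤ := M (u n) 0 0
def e (n : ℕ) : ℤ := M (u n) 0 1
def d (n : ℕ) : ℤ := M (u n) 1 0
def f (n : ℕ) : ℤ := M (u n) 1 1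
def w (n : ℕ) : ℤ := M (v n) 0 0
def y (n : ℕ) : ℤ := M (v n) 0 1
def x (n : ℕ) : ℤ := M (v n) 1 0
def z (n : ℕ) : ℤ := M (v n) 1 1
def g (n : ℕ) : ℤ := c n + 2 * e n + f n
def r (n : ℕ) : ℤ := 2 ^ n * (w n + x n) + w n + y n + z n

end Paper

open Paper Filter Real

namespace Paper

lemma s_two_pow_add {n i : ℕ} (hi : i + 1 < 2 ^ n) : s (2 ^ n + i) = s i := by
  unfold s
  congr 1
  set t := padicValNat 2 (2 ^ n + i + 1)
  have htdvd : 2 ^ t ∣ 2 ^ n + (i + 1) := pow_padicValNat_dvd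
  have htn : t ≤ n := by
    have hle := Nat.le_of_dvd (by positivity) htdvd
    have hlt : 2 ^ t < 2 ^ (n + 1) := by rw [pow_succ]; omega
    exact Nat.lt_succ_iff.1 ((Nat.pow_lt_pow_iff_right one_lt_two).1 hlt)
  have hn : padicValNat 2 (i + 1) ≤ n :=
    ((Nat.pow_lt_pow_iff_right one_lt_two).1
      ((Nat.le_of_dvd i.succ_pos pow_padicValNat_dvd).trans_lt hi)).le
  apply le_antisymm
  · exact (padicValNat_dvd_iff_le i.succ_ne_zero).1
      ((Nat.dvd_add_right (pow_dvd_pow 2 htn)).1 htdvd)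
  · exact (padicValNat_dvd_iff_le (Nat.succ_ne_zero _)).1
      (dvd_add (pow_dvd_pow 2 hn) pow_padicValNat_dvd)

lemma s_two_pow_sub_one (n : ℕ) : s (2 ^ n - 1) = 2 ^ n := by
  unfold s
  rw [Nat.sub_add_cancel Nat.one_le_two_pow, padicValNat.prime_pow]

lemma v_succ {n : ℕ} (hn : 1 ≤ n) : v (n + 1) = v n ++ [2 ^ n, 1] ++ v n := by
  obtain ⟨m, hm⟩ : ∃ m, 2 ^ n = m + 2 :=
    ⟨2 ^ n - 2, by have := Nat.pow_le_pow_right (n := 2) two_pos hn; omega⟩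
  have hlen : 2 ^ (n + 1) - 2 = m + 2 + m := by rw [pow_succ]; omega
  have h₁ : s (m + 1) = 2 ^ n := by
    rw [← s_two_pow_sub_one n]; congr 1; omega
  have h₂ : s (m + 1 + 1) = 1 := by
    have h := s_two_pow_add (n := n) (i := 0) (by omega)
    rw [hm] at h
    rw [h]; simp [s]
  have h₃ : ∀ i ∈ List.range m, (s (m + 2 + i + 1) : ℤ) = s (i + 1) := by
    intro i hi
    rw [List.mem_range] at hi
    rw [add_assoc, ← hm, s_two_pow_add (by omega)]
  unfold v
  rw [hlen, hm, Nat.add_sub_cancel, List.range_add, List.map_append, List.map_map,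
    List.range_succ, List.range_succ]
  simp only [List.map_append, List.map_cons, List.map_nil, h₁, h₂, List.append_assoc]
  congr 1
  simp only [List.cons_append, List.nil_append]
  push_cast
  congr 2
  exact List.map_congr_left h₃

lemma M_append (l l' : List ℤ) : M (l ++ l') = M l * M l' := by
  simp [M]

lemma M_v_succ {n : ℕ} (hn : 1 ≤ n) :
    M (v (n + 1)) = M (v n) * !![2 ^ n + 1, 2 ^ n; 1, 1] * M (v n) := by
  rw [v_succ hn, M_append, M_append]
  simp [M]

lemma M_v_eq (n : ℕ) : M (v n) = !![w n, y n; x n, z n] :=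
  Matrix.eta_fin_two _

lemma M_v_succ_eq {n : ℕ} (hn : 1 ≤ n) :
    !![w (n + 1), y (n + 1); x (n + 1), z (n + 1)] =
      !![w n, y n; x n, z n] * !![2 ^ n + 1, 2 ^ n; 1, 1] * !![w n, y n; x n, z n] := by
  simpa only [M_v_eq] using M_v_succ hn

lemma w_succ {n : ℕ} (hn : 1 ≤ n) :
    w (n + 1) = (w n * (2 ^ n + 1) + y n) * w n + (w n * 2 ^ n + y n) * x n := by
  simpa using congr_fun₂ (M_v_succ_eq hn) 0 0

lemma y_succ {n : ℕ} (hn : 1 ≤ n) :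
    y (n + 1) = (w n * (2 ^ n + 1) + y n) * y n + (w n * 2 ^ n + y n) * z n := by
  simpa using congr_fun₂ (M_v_succ_eq hn) 0 1

lemma x_succ {n : ℕ} (hn : 1 ≤ n) :
    x (n + 1) = (x n * (2 ^ n + 1) + z n) * w n + (x n * 2 ^ n + z n) * x n := by
  simpa using congr_fun₂ (M_v_succ_eq hn) 1 0

lemma z_succ {n : ℕ} (hn : 1 ≤ n) :
    z (n + 1) = (x n * (2 ^ n + 1) + z n) * y n + (x n * 2 ^ n + z n) * z n := by
  simpa using congr_fun₂ (M_v_succ_eq hn) 1 1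

lemma det_v {n : ℕ} (hn : 1 ≤ n) : w n * z n - y n * x n = 1 := by
  suffices h : (M (v n)).det = 1 by rwa [M_v_eq, Matrix.det_fin_two_of] at h
  induction n, hn using Nat.le_induction with
  | base => simp [M, v]
  | succ k hk ih => rw [M_v_succ hk, Matrix.det_mul, Matrix.det_mul, ih]; simp

lemma w_eq_y_add_z {n : ℕ} (hn : 1 ≤ n) : w n = y n + z n := by
  induction n, hn using Nat.le_induction with
  | base => simp [w, y, z, M, v]
  | succ k hk ih =>
    rw [w_succ hk, y_succ hk, z_succ hk, ih]
    ring

lemma r_pos {n : ℕ} (hn : 1 ≤ n) : 0 < r n := by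
  have h : 0 < w n ∧ 0 ≤ x n ∧ 0 ≤ y n ∧ 0 ≤ z n := by
    induction n, hn using Nat.le_induction with
    | base => simp [w, x, y, z, M, v]
    | succ k hk ih =>
      obtain ⟨hw, hx, hy, hz⟩ := ih
      rw [w_succ hk, x_succ hk, y_succ hk, z_succ hk]
      refine ⟨?_, ?_, ?_, ?_⟩ <;> positivity
  obtain ⟨hw, hx, hy, hz⟩ := h
  unfold r
  positivity

end Paper

/-- For n ≥ 2, `r_n` divides `2^n x_{n+1}² + x_{n+1} z_{n+1} + 1`, with the stated quotient. -/
theorem r_dvd_and_quotient (n : ℕ) (hn : 2 ≤ n) :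
    r n ∣ (2 ^ n * x (n + 1) ^ 2 + x (n + 1) * z (n + 1) + 1) ∧
    (2 ^ n * x (n + 1) ^ 2 + x (n + 1) * z (n + 1) + 1) / r n =
      (2 ^ n + 1) * w n * x n * z n + 2 ^ n * (2 ^ n + 1) * w n * x n ^ 2
        + z n + (2 ^ n - 1) * x n + 2 ^ n * x n ^ 2 * y n
        + 2 ^ (n + 1) * x n ^ 2 * z n + x n * y n * z n
        + 2 ^ (2 * n) * x n ^ 3 + x n * z n ^ 2 := by
  have hn' : 1 ≤ n := by omega
  have hdet := det_v hn'
  have key : 2 ^ n * x (n + 1) ^ 2 + x (n + 1) * z (n + 1) + 1 = r n *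
      ((2 ^ n + 1) * w n * x n * z n + 2 ^ n * (2 ^ n + 1) * w n * x n ^ 2
        + z n + (2 ^ n - 1) * x n + 2 ^ n * x n ^ 2 * y n
        + 2 ^ (n + 1) * x n ^ 2 * z n + x n * y n * z n
        + 2 ^ (2 * n) * x n ^ 3 + x n * z n ^ 2) := by
    rw [x_succ hn', z_succ hn', r, w_eq_y_add_z hn', pow_succ (2 : ℤ) n, mul_comm 2 n, pow_mul]
    rw [w_eq_y_add_z hn'] at hdet
    generalize (2 : ℤ) ^ n = N at *
    linear_combination (N * z n ^ 2 + z n ^ 2 + N ^ 2 * x n * z n + 2 * N * x n * z n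
      + N * y n * z n - 2 * x n * z n + y n * z n + N ^ 2 * x n * y n + N ^ 2 * x n ^ 2
      + N * x n * y n - N * x n ^ 2 - x n * y n - 1) * hdet
  rw [key]
  exact ⟨dvd_mul_right _ _, Int.mul_ediv_cancel_left _ (r_pos hn').ne'⟩
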